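/- Let V = Fin 5 → ZMod 2 with standard basis e₀, e₁, e₂, e₃, e₄. Let ι : V → V be the linear map determined by ι(e₀) = e₀ + e₁ + e₂ + e₄, ι(e₁) = e₁ + e₄, ι(e₂) = e₂ + e₄, ι(e₃) = e₁ + e₂ + e₃, ι(e₄) = e₄, and let τ : V → V be the linear map determined by τ(e₀) = e₀, τ(e₁) = e₂, τ(e₂) = e₁, τ(e₃) = e₃ + e₄, τ(e₄) = e₄. Then every v ∈ V satisfying ι v = v and τ v = v has first coordinate v 0 = 0. (This is the algebraic content of Lemma: there is no U-nontorsion class in H_*(A₀(4₁ # 4₁ʳ)) of Maslov grading zero invariant under both ι and τ, since a grading-zero class is U-nontorsion exactly when its e₀-coefficient is nonzero.) -/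

import Mathlib

/-- The standard basis vectors of `Fin 5 → ZMod 2`. -/
noncomputable def e (i : Fin 5) : Fin 5 → ZMod 2 := Pi.single i 1

theorem stmt_5 (ι τ : (Fin 5 → ZMod 2) →ₗ[ZMod 2] (Fin 5 → ZMod 2))
    (hι0 : ι (e 0) = e 0 + e 1 + e 2 + e 4)
    (hι1 : ι (e 1) = e 1 + e 4)
    (hι2 : ι (e 2) = e 2 + e 4)
    (hι3 : ι (e 3) = e 1 + e 2 + e 3)
    (hι4 : ι (e 4) = e 4)
    (hτ0 : τ (e 0) = e 0)
    (hτ1 : τ (e 1) = e 2)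
    (hτ2 : τ (e 2) = e 1)
    (hτ3 : τ (e 3) = e 3 + e 4)
    (hτ4 : τ (e 4) = e 4)
    (v : Fin 5 → ZMod 2) (hv1 : ι v = v) (hv2 : τ v = v) :
    v 0 = 0 := by
  have hv : v = v 0 • e 0 + v 1 • e 1 + v 2 • e 2 + v 3 • e 3 + v 4 • e 4 := by
    ext i
    fin_cases i <;> simp [e]
  have hι : v 0 + v 1 + v 3 = v 1 := by
    rw [hv] at hv1
    simp only [map_add, map_smul, hι0, hι1, hι2, hι3, hι4] at hv1
    simpa [e] using congrFun hv1 1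
  have hτ : v 3 + v 4 = v 4 := by
    rw [hv] at hv2
    simp only [map_add, map_smul, hτ0, hτ1, hτ2, hτ3, hτ4] at hv2
    simpa [e] using congrFun hv2 4
  linear_combination hι - hτ
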